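/- Let X = (X_1, …, X_n) be a centered Gaussian random vector in ℝ^n, let σ² = max_{1≤i≤n} Var(X_i) with σ > 0, and let μ(X) = E[ max_{1≤i≤n} X_i ]. Then for every u ≥ 0, P( max_{1≤i≤n} X_i > u + μ(X) ) ≤ exp(−u²/(2σ²)). -/

import Mathlib

open MeasureTheory ProbabilityTheory
open scoped NNReal ENNReal

lemma exp_le_quadratic_add_remainder {l y s w : ℝ} (hl : 0 ≤ l) (hs : 0 ≤ s) (hs1 : s ≤ 1)
    (hy : |y| ≤ s * w) :
    Real.exp (l * y) ≤
      1 + l * y + l ^ 2 / 2 * y ^ 2 + s ^ 3 * (6 * l ^ 3 * Real.exp ((l + 1) * w)) := by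
  have hw : 0 ≤ s * w := (abs_nonneg y).trans hy
  have hyw : |y| ≤ |w| := by
    refine hy.trans ?_
    rw [← abs_of_nonneg hw, abs_mul, abs_of_nonneg hs]
    exact mul_le_of_le_one_left (abs_nonneg w) hs1
  rcases hs.eq_or_lt with rfl | hs0
  · have : y = 0 := by simpa using hy
    simp [this]
  have hw0 : 0 ≤ w := nonneg_of_mul_nonneg_right hw hs0
  rw [abs_of_nonneg hw0] at hyw
  have h1 : |Real.exp (l * y) - (1 + l * y + (l * y) ^ 2 / 2)| ≤
      |l * y| ^ 3 * Real.exp |l * y| := by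
    have h := Complex.norm_exp_sub_sum_le_norm_mul_exp ((l * y : ℝ) : ℂ) 3
    simp only [Finset.sum_range_succ, Finset.sum_range_zero] at h
    norm_num [Nat.factorial] at h
    have e : (Complex.exp (l * y) - (1 + (l : ℂ) * y + ((l : ℂ) * y) ^ 2 / 2)) =
        ((Real.exp (l * y) - (1 + l * y + (l * y) ^ 2 / 2) : ℝ) : ℂ) := by push_cast; ring
    rw [e, Complex.norm_real, Real.norm_eq_abs] at h
    rwa [abs_mul]
  have h2 : |l * y| ^ 3 * Real.exp |l * y| ≤ s ^ 3 * (6 * l ^ 3 * Real.exp ((l + 1) * w)) := by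
    have hw3 : w ^ 3 ≤ 6 * Real.exp w := by
      have := Real.pow_div_factorial_le_exp w hw0 3
      norm_num [Nat.factorial] at this
      linarith
    rw [abs_mul, abs_of_nonneg hl]
    calc (l * |y|) ^ 3 * Real.exp (l * |y|)
        ≤ (l * (s * w)) ^ 3 * Real.exp (l * w) := by gcongr
      _ = s ^ 3 * l ^ 3 * Real.exp (l * w) * w ^ 3 := by ring
      _ ≤ s ^ 3 * l ^ 3 * Real.exp (l * w) * (6 * Real.exp w) := by gcongr
      _ = s ^ 3 * (6 * l ^ 3 * (Real.exp (l * w) * Real.exp w)) := by ring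
      _ = _ := by rw [← Real.exp_add]; ring_nf
  have h3 := (abs_le.1 (h1.trans h2)).2
  linarith [mul_pow l y 2]

section Concentration

variable {E : Type*} [NormedAddCommGroup E] [NormedSpace ℝ E] [MeasurableSpace E] [BorelSpace E]

lemma integrable_exp_mul_norm_of_isGaussian [SecondCountableTopology E] [CompleteSpace E]
    (μ : Measure E) [IsGaussian μ] (c : ℝ) : Integrable (fun x => Real.exp (c * ‖x‖)) μ := by
  obtain ⟨C, hC, hexpi⟩ := IsGaussian.exists_integrable_exp_sq μ
  refine (hexpi.const_mul (Real.exp (c ^ 2 / (4 * C)))).mono' (by fun_prop) (ae_of_all _ fun x => ?_)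
  rw [Real.norm_eq_abs, Real.abs_exp, ← Real.exp_add, Real.exp_le_exp]
  have : c ^ 2 / (4 * C) + C * ‖x‖ ^ 2 - c * ‖x‖ = (c - 2 * C * ‖x‖) ^ 2 / (4 * C) := by
    field_simp; ring
  have : 0 ≤ (c - 2 * C * ‖x‖) ^ 2 / (4 * C) := by positivity
  linarith

/-- Short-time bound on the Laplace transform of `z ↦ g (s • z)` as `s → 0`, uniform over functions
`g` of linear growth that are approximated to second order by a linear form of variance at most
`σ ^ 2`. -/
lemma exists_integral_exp_le [SecondCountableTopology E]
    (μ : Measure E) [IsProbabilityMeasure μ]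
    (hμ : ∀ c : ℝ, Integrable (fun x => Real.exp (c * ‖x‖)) μ)
    {l B σ : ℝ} (hl : 0 ≤ l) (hB : 0 ≤ B) :
    ∃ C : ℝ, ∀ (g : E → ℝ) (L : StrongDual ℝ E), Continuous g → (∀ z, |g z| ≤ ‖z‖) →
      (∀ z, |g z - L z| ≤ B * ‖z‖ ^ 2) → ‖L‖ ≤ 1 → ∫ z, (L z) ^ 2 ∂μ ≤ σ ^ 2 →
      ∀ s : ℝ, 0 ≤ s → s ≤ 1 →
      ∫ z, Real.exp (l * g (s • z)) ∂μ ≤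
        Real.exp (l * ∫ z, g (s • z) ∂μ + (s ^ 2 * (l ^ 2 * σ ^ 2 / 2) + C * s ^ 3)) := by
  have hexp1 : Integrable (fun x => Real.exp ‖x‖) μ := by simpa using hμ 1
  have hn1 : Integrable (fun x : E => ‖x‖) μ := by
    refine hexp1.mono' (by fun_prop) (ae_of_all _ fun x => ?_)
    rw [norm_norm]
    linarith [Real.add_one_le_exp ‖x‖]
  have hn2 : Integrable (fun x : E => ‖x‖ ^ 2) μ := by
    refine (hexp1.const_mul 2).mono' (by fun_prop) (ae_of_all _ fun x => ?_)
    have := Real.pow_div_factorial_le_exp ‖x‖ (norm_nonneg x) 2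
    norm_num [Nat.factorial] at this ⊢
    linarith
  have hn3 : Integrable (fun x : E => ‖x‖ ^ 3) μ := by
    refine (hexp1.const_mul 6).mono' (by fun_prop) (ae_of_all _ fun x => ?_)
    have := Real.pow_div_factorial_le_exp ‖x‖ (norm_nonneg x) 3
    norm_num [Nat.factorial] at this ⊢
    linarith
  set M := ∫ x, ‖x‖ ∂μ with hM
  have hexpW : Integrable (fun x : E => Real.exp ((l + 1) * (‖x‖ + M))) μ := by
    simp_rw [mul_add, Real.exp_add]
    exact (hμ (l + 1)).mul_const _
  refine ⟨l ^ 2 * B * (∫ x, ‖x‖ ^ 3 ∂μ) + 6 * l ^ 3 * ∫ x, Real.exp ((l + 1) * (‖x‖ + M)) ∂μ, ?_⟩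
  intro g L hg hgn hgL hL hLσ s hs hs1
  have hgs : ∀ z, |g (s • z)| ≤ s * ‖z‖ := fun z => by
    simpa [norm_smul, abs_of_nonneg hs] using hgn (s • z)
  have hgi : Integrable (fun z => g (s • z)) μ :=
    (hn1.const_mul s).mono' (by fun_prop) (ae_of_all _ hgs)
  have hg2i : Integrable (fun z => g (s • z) ^ 2) μ := by
    refine (hn2.const_mul (s ^ 2)).mono' (by fun_prop) (ae_of_all _ fun z => ?_)
    rw [Real.norm_eq_abs, abs_pow, ← mul_pow]
    gcongr
    exact hgs z
  have hLi : Integrable (fun z => (L z) ^ 2) μ := by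
    refine hn2.mono' (by fun_prop) (ae_of_all _ fun z => ?_)
    rw [Real.norm_eq_abs, abs_pow]
    gcongr
    simpa using L.le_of_opNorm_le hL z
  set m := ∫ z, g (s • z) ∂μ with hm
  have hmM : |m| ≤ s * M := by
    rw [hm, hM, ← integral_const_mul]
    exact (abs_integral_le_integral_abs).trans (integral_mono hgi.abs (hn1.const_mul s) hgs)
  have hY : ∀ z, |g (s • z) - m| ≤ s * (‖z‖ + M) := fun z => by
    rw [mul_add]
    exact (abs_sub _ _).trans (add_le_add (hgs z) hmM)
  have hYi : Integrable (fun z => g (s • z) - m) μ := hgi.sub (integrable_const m)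
  have hY2 : (fun z => (g (s • z) - m) ^ 2) =
      fun z => g (s • z) ^ 2 - 2 * m * g (s • z) + m ^ 2 := by
    ext z; ring
  have hcross : Integrable (fun z => g (s • z) ^ 2 - 2 * m * g (s • z)) μ :=
    hg2i.sub (hgi.const_mul _)
  have hY2i : Integrable (fun z => (g (s • z) - m) ^ 2) μ := by
    rw [hY2]
    exact hcross.add (integrable_const _)
  have hvar : ∫ z, (g (s • z) - m) ^ 2 ∂μ ≤ s ^ 2 * σ ^ 2 + s ^ 3 * (2 * B * ∫ x, ‖x‖ ^ 3 ∂μ) := by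
    calc ∫ z, (g (s • z) - m) ^ 2 ∂μ = ∫ z, g (s • z) ^ 2 ∂μ - m ^ 2 := by
          rw [hY2, integral_add hcross (integrable_const _),
            integral_sub hg2i (hgi.const_mul _), integral_const_mul, ← hm]
          simp; ring
      _ ≤ ∫ z, g (s • z) ^ 2 ∂μ := by linarith [sq_nonneg m]
      _ ≤ ∫ z, (s ^ 2 * (L z) ^ 2 + s ^ 3 * (2 * B) * ‖z‖ ^ 3) ∂μ := by
          refine integral_mono hg2i ((hLi.const_mul _).add (hn3.const_mul _)) fun z => ?_
          have h1 : |g (s • z) - s * L z| ≤ B * (s ^ 2 * ‖z‖ ^ 2) := by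
            simpa [norm_smul, abs_of_nonneg hs, mul_pow] using hgL (s • z)
          have hLz : |L z| ≤ ‖z‖ := by simpa using L.le_of_opNorm_le hL z
          have h2 : |g (s • z) + s * L z| ≤ 2 * (s * ‖z‖) := by
            refine (abs_add_le _ _).trans ?_
            rw [abs_mul, abs_of_nonneg hs]
            linarith [hgs z, mul_le_mul_of_nonneg_left hLz hs]
          have h3 : |(g (s • z) - s * L z) * (g (s • z) + s * L z)| ≤
              B * (s ^ 2 * ‖z‖ ^ 2) * (2 * (s * ‖z‖)) := by
            rw [abs_mul]; gcongr
          have := (abs_le.1 h3).2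
          simp only
          nlinarith
      _ = s ^ 2 * ∫ z, (L z) ^ 2 ∂μ + s ^ 3 * (2 * B) * ∫ x, ‖x‖ ^ 3 ∂μ := by
          rw [integral_add (hLi.const_mul _) (hn3.const_mul _), integral_const_mul,
            integral_const_mul]
      _ ≤ _ := by
          rw [mul_assoc (s ^ 3)]
          gcongr
  have hrem := (hexpW.const_mul (6 * l ^ 3)).const_mul (s ^ 3)
  have hlin : Integrable (fun z => 1 + l * (g (s • z) - m)) μ :=
    (integrable_const 1).add (hYi.const_mul l)
  have hquad : Integrable
      (fun z => 1 + l * (g (s • z) - m) + l ^ 2 / 2 * (g (s • z) - m) ^ 2) μ :=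
    hlin.add (hY2i.const_mul (l ^ 2 / 2))
  have hmain : ∫ z, Real.exp (l * (g (s • z) - m)) ∂μ ≤
      1 + l ^ 2 / 2 * ∫ z, (g (s • z) - m) ^ 2 ∂μ +
        s ^ 3 * (6 * l ^ 3 * ∫ x, Real.exp ((l + 1) * (‖x‖ + M)) ∂μ) := by
    calc _ ≤ ∫ z, (1 + l * (g (s • z) - m) + l ^ 2 / 2 * (g (s • z) - m) ^ 2 +
          s ^ 3 * (6 * l ^ 3 * Real.exp ((l + 1) * (‖z‖ + M)))) ∂μ := by
          refine integral_mono_of_nonneg (ae_of_all _ fun z => (Real.exp_pos _).le)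
            (hquad.add hrem) (ae_of_all _ fun z => ?_)
          exact exp_le_quadratic_add_remainder hl hs hs1 (hY z)
      _ = _ := by
          have hY0 : ∫ z, (g (s • z) - m) ∂μ = 0 := by
            rw [integral_sub hgi (integrable_const m), ← hm]; simp
          rw [integral_add hquad hrem, integral_add hlin (hY2i.const_mul (l ^ 2 / 2)),
            integral_add (integrable_const (1 : ℝ)) (hYi.const_mul l)]
          simp only [integral_const_mul, hY0]
          simp
  have hsplit : ∀ z, Real.exp (l * g (s • z)) =
      Real.exp (l * m) * Real.exp (l * (g (s • z) - m)) := fun z => by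
    rw [← Real.exp_add]; ring_nf
  simp_rw [hsplit]
  rw [integral_const_mul, Real.exp_add]
  gcongr
  refine (hmain.trans ?_).trans (Real.add_one_le_exp _)
  have := mul_le_mul_of_nonneg_left hvar (by positivity : 0 ≤ l ^ 2 / 2)
  linarith

section Semigroup

variable [SecondCountableTopology E] [CompleteSpace E]

/-- A centered Gaussian measure is stable under convolution of rescaled copies. -/
lemma map_smul_conv_map_smul (μ : Measure E) [IsGaussian μ]
    (hμ : ∀ L : StrongDual ℝ E, μ[L] = 0) {a b c : ℝ} (h : a ^ 2 + b ^ 2 = c ^ 2) :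
    (μ.map (fun x => a • x)) ∗ (μ.map (fun x => b • x)) = μ.map (fun x => c • x) := by
  have key : ∀ (t : ℝ) (L : StrongDual ℝ E),
      charFunDual (μ.map (fun x => t • x)) L = Complex.exp (-(t ^ 2 * Var[L; μ] : ℝ) / 2) := by
    intro t L
    have e : (fun x : E => t • x) = ⇑(t • ContinuousLinearMap.id ℝ E) := by ext; simp
    have e2 : L.comp (t • ContinuousLinearMap.id ℝ E) = t • L := by ext; simp
    rw [e, charFunDual_map, e2,
      IsGaussian.charFunDual_eq_of_forall_strongDual_eq_zero hμ (t • L)]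
    have e3 : Var[⇑(t • L); μ] = t ^ 2 * Var[L; μ] := variance_const_mul t L μ
    rw [e3]
  have : ∀ t : ℝ, IsProbabilityMeasure (μ.map (fun x => t • x)) := fun t =>
    Measure.isProbabilityMeasure_map (by fun_prop)
  refine Measure.ext_of_charFunDual ?_
  ext L
  rw [charFunDual_conv, key, key, key, ← Complex.exp_add, ← h]
  congr 1
  push_cast
  ring

lemma integral_smul_eq_integral_integral (μ : Measure E) [IsGaussian μ]
    (hμ : ∀ L : StrongDual ℝ E, μ[L] = 0) {a b c : ℝ} (h : a ^ 2 + b ^ 2 = c ^ 2)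
    {f : E → ℝ} (hf : Continuous f) (hfi : Integrable (fun x => f (c • x)) μ) :
    Integrable (fun z => ∫ y, f (a • z + b • y) ∂μ) μ ∧
      ∫ x, f (c • x) ∂μ = ∫ z, ∫ y, f (a • z + b • y) ∂μ ∂μ := by
  have : ∀ t : ℝ, IsProbabilityMeasure (μ.map (fun x => t • x)) := fun t =>
    Measure.isProbabilityMeasure_map (by fun_prop)
  have hconv := map_smul_conv_map_smul μ hμ h
  have hi : Integrable f (μ.map (fun x => a • x) ∗ μ.map (fun x => b • x)) := by
    rw [hconv, integrable_map_measure hf.aestronglyMeasurable (by fun_prop)]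
    exact hfi
  have hinner : ∀ z, ∫ y, f (z + y) ∂(μ.map (fun x => b • x)) = ∫ y, f (z + b • y) ∂μ := fun z =>
    integral_map (by fun_prop) (by fun_prop)
  have hi' : Integrable (fun p : E × E => f (p.1 + p.2))
      ((μ.map (fun x => a • x)).prod (μ.map (fun x => b • x))) :=
    (integrable_map_measure (f := fun p : E × E => p.1 + p.2) hf.aestronglyMeasurable
      (by fun_prop)).1 hi
  have hi2 := hi'.integral_prod_left
  simp only [hinner] at hi2
  constructor
  · exact (integrable_map_measure hi2.aestronglyMeasurable (by fun_prop)).1 hi2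
  · rw [← integral_map (φ := fun x => c • x) (by fun_prop) hf.aestronglyMeasurable, ← hconv,
      integral_conv hi]
    simp only [hinner]
    exact integral_map (by fun_prop) hi2.aestronglyMeasurable

/-- Gaussian concentration, in terms of the Laplace transform and with the sharp constant, for a
Lipschitz function with a quadratically accurate linear approximation. -/
theorem integral_exp_mul_le_of_isGaussian (μ : Measure E) [IsGaussian μ]
    [SecondCountableTopology (StrongDual ℝ E)]
    (hμ : ∀ L : StrongDual ℝ E, μ[L] = 0) {K : Set (StrongDual ℝ E)} (hK : Convex ℝ K)
    (hKc : IsClosed K) (hK1 : ∀ L ∈ K, ‖L‖ ≤ 1) {σ : ℝ}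
    (hKσ : ∀ L ∈ K, ∫ z, (L z) ^ 2 ∂μ ≤ σ ^ 2) {F : E → ℝ} {F' : E → StrongDual ℝ E}
    (hF : LipschitzWith 1 F) (hF' : Continuous F') (hF'K : ∀ x, F' x ∈ K) {B : ℝ} (hB : 0 ≤ B)
    (hFF' : ∀ x z, |F (x + z) - F x - F' x z| ≤ B * ‖z‖ ^ 2) {l : ℝ} (hl : 0 ≤ l) :
    ∫ x, Real.exp (l * F x) ∂μ ≤ Real.exp (l * ∫ x, F x ∂μ + l ^ 2 * σ ^ 2 / 2) := by
  have hexp := integrable_exp_mul_norm_of_isGaussian μ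
  have hFc := hF.continuous
  have hFd : ∀ x y, |F x - F y| ≤ ‖x - y‖ := fun x y => by
    simpa [Real.dist_eq, dist_eq_norm] using hF.dist_le_mul x y
  have hn1 : Integrable (fun x : E => ‖x‖) μ := (IsGaussian.integrable_id (μ := μ)).norm
  have hgrow : ∀ x y, |F (x + y)| ≤ |F x| + ‖y‖ := fun x y => by
    have := hFd (x + y) x
    rw [add_sub_cancel_left] at this
    linarith [abs_sub_abs_le_abs_sub (F (x + y)) (F x)]
  have hFi : ∀ (x : E) (c : ℝ), Integrable (fun y => F (x + c • y)) μ := fun x c => by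
    refine ((integrable_const |F x|).add (hn1.const_mul |c|)).mono' (by fun_prop)
      (ae_of_all _ fun y => ?_)
    simpa [norm_smul] using hgrow x (c • y)
  have hEi : ∀ (x : E) (c : ℝ), Integrable (fun y => Real.exp (l * F (x + c • y))) μ :=
    fun x c => by
    refine ((hexp (l * |c|)).const_mul (Real.exp (l * |F x|))).mono' (by fun_prop)
      (ae_of_all _ fun y => ?_)
    rw [Real.norm_eq_abs, Real.abs_exp, ← Real.exp_add, Real.exp_le_exp]
    have := (le_abs_self _).trans (hgrow x (c • y))
    rw [norm_smul, Real.norm_eq_abs] at this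
    nlinarith
  have hF'i : ∀ (x : E) (c : ℝ), Integrable (fun y => F' (x + c • y)) μ := fun x c => by
    refine (integrable_const (1 : ℝ)).mono' (by fun_prop) (ae_of_all _ fun y => hK1 _ (hF'K _))
  obtain ⟨C, hC⟩ := exists_integral_exp_le μ hexp (σ := σ) hl hB
  have hind : ∀ s : ℝ, 0 ≤ s → s ≤ 1 → ∀ (k : ℕ) (x : E),
      ∫ y, Real.exp (l * F (x + (√k * s) • y)) ∂μ ≤
        Real.exp (l * ∫ y, F (x + (√k * s) • y) ∂μ +
          k * (s ^ 2 * (l ^ 2 * σ ^ 2 / 2) + C * s ^ 3)) := by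
    intro s hs hs1 k
    induction k with
    | zero => intro x; simp
    | succ k ih =>
      intro x
      have hsq : s ^ 2 + (√k * s) ^ 2 = (√(k + 1 : ℕ) * s) ^ 2 := by
        rw [mul_pow, mul_pow, Real.sq_sqrt (by positivity), Real.sq_sqrt (by positivity)]
        push_cast; ring
      obtain ⟨h1i, h1⟩ := integral_smul_eq_integral_integral μ hμ hsq
        (f := fun w => Real.exp (l * F (x + w))) (by fun_prop) (hEi x _)
      obtain ⟨h2i, h2⟩ := integral_smul_eq_integral_integral μ hμ hsq
        (f := fun w => F (x + w)) (by fun_prop) (hFi x _)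
      rw [h1, h2]
      simp only [← add_assoc] at h1i h2i ⊢
      set r := √k * s
      set G : E → ℝ := fun z => ∫ y, F (z + r • y) ∂μ with hG
      have hGd : ∀ z w, |G z - G w| ≤ ‖z - w‖ := fun z w => by
        rw [hG]
        simp only
        rw [← integral_sub (hFi z r) (hFi w r)]
        have := norm_integral_le_of_norm_le_const (μ := μ) (C := ‖z - w‖)
          (f := fun y => F (z + r • y) - F (w + r • y)) (ae_of_all _ fun y => by
            simpa using hFd (z + r • y) (w + r • y))
        simpa using this
      have hGc : Continuous G := by
        refine (LipschitzWith.of_dist_le_mul (K := 1) fun z w => ?_).continuous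
        simpa [Real.dist_eq, dist_eq_norm] using hGd z w
      set L : StrongDual ℝ E := ∫ y, F' (x + r • y) ∂μ with hL
      have hLK : L ∈ K := hK.integral_mem hKc (ae_of_all _ fun y => hF'K _) (hF'i x r)
      have hGL : ∀ z, |G (x + z) - G x - L z| ≤ B * ‖z‖ ^ 2 := fun z => by
        have hi3 : Integrable (fun y => F' (x + r • y) z) μ :=
          (ContinuousLinearMap.apply ℝ ℝ z).integrable_comp (hF'i x r)
        have hdi : Integrable (fun y => F (x + z + r • y) - F (x + r • y)) μ :=
          (hFi (x + z) r).sub (hFi x r)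
        rw [hG, hL, ContinuousLinearMap.integral_apply (hF'i x r)]
        simp only
        rw [← integral_sub (hFi (x + z) r) (hFi x r),
          ← integral_sub hdi hi3]
        have := norm_integral_le_of_norm_le_const (μ := μ) (C := B * ‖z‖ ^ 2)
          (f := fun y => F (x + z + r • y) - F (x + r • y) - F' (x + r • y) z)
          (ae_of_all _ fun y => by
            simpa [add_right_comm] using hFF' (x + r • y) z)
        simpa using this
      have hstep := hC (fun z => G (x + z) - G x) L (by fun_prop)
        (fun z => by simpa using hGd (x + z) x) hGL (hK1 L hLK) (hKσ L hLK) s hs hs1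
      have hGi : Integrable (fun z => G (x + s • z)) μ := h2i
      have hstep' : ∫ z, Real.exp (l * G (x + s • z)) ∂μ ≤ Real.exp (l * ∫ z, G (x + s • z) ∂μ +
          (s ^ 2 * (l ^ 2 * σ ^ 2 / 2) + C * s ^ 3)) := by
        have e : ∀ z, Real.exp (l * G (x + s • z)) =
            Real.exp (l * G x) * Real.exp (l * (G (x + s • z) - G x)) := fun z => by
          rw [← Real.exp_add]; ring_nf
        simp_rw [e]
        rw [integral_const_mul]
        refine (mul_le_mul_of_nonneg_left hstep (Real.exp_pos _).le).trans_eq ?_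
        rw [← Real.exp_add, integral_sub hGi (integrable_const _)]
        simp only [integral_const, probReal_univ, one_smul]
        ring_nf
      have hEGi : Integrable (fun z => Real.exp (l * G (x + s • z))) μ := by
        refine ((hexp (l * s)).const_mul (Real.exp (l * |G x|))).mono' (by fun_prop)
          (ae_of_all _ fun y => ?_)
        rw [Real.norm_eq_abs, Real.abs_exp, ← Real.exp_add, Real.exp_le_exp]
        have h4 := hGd (x + s • y) x
        rw [add_sub_cancel_left, norm_smul, Real.norm_eq_abs, abs_of_nonneg hs] at h4
        have h5 := (abs_le.1 h4).2
        have h6 := le_abs_self (G x)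
        nlinarith
      change _ ≤ Real.exp (l * ∫ z, G (x + s • z) ∂μ + _)
      calc ∫ z, ∫ y, Real.exp (l * F (x + s • z + r • y)) ∂μ ∂μ
          ≤ ∫ z, Real.exp (l * G (x + s • z)) *
              Real.exp (k * (s ^ 2 * (l ^ 2 * σ ^ 2 / 2) + C * s ^ 3)) ∂μ := by
            refine integral_mono h1i (hEGi.mul_const _) fun z => ?_
            simp only
            rw [← Real.exp_add]
            exact ih (x + s • z)
        _ ≤ _ := by
            rw [integral_mul_const]
            refine (mul_le_mul_of_nonneg_right hstep' (Real.exp_pos _).le).trans_eq ?_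
            rw [← Real.exp_add]
            push_cast
            ring_nf
  have hN : ∀ N : ℕ, ∫ x, Real.exp (l * F x) ∂μ ≤
      Real.exp (l * ∫ x, F x ∂μ + (l ^ 2 * σ ^ 2 / 2 + C * (√((N : ℝ) + 1))⁻¹)) := fun N => by
    have hpos : 0 < √((N : ℝ) + 1) := by positivity
    have hge : 1 ≤ √((N : ℝ) + 1) := Real.one_le_sqrt.2 (by linarith [N.cast_nonneg (α := ℝ)])
    have h := hind (√((N : ℝ) + 1))⁻¹ (by positivity) (inv_le_one_of_one_le₀ hge) (N + 1) 0
    push_cast at h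
    rw [mul_inv_cancel₀ hpos.ne'] at h
    simp only [one_smul, zero_add] at h
    convert h using 3
    have hs2 : (N : ℝ) + 1 = √((N : ℝ) + 1) ^ 2 := (Real.sq_sqrt (by positivity)).symm
    generalize √((N : ℝ) + 1) = q at *
    rw [hs2]
    field_simp
  have hlim : Filter.Tendsto (fun N : ℕ => Real.exp (l * ∫ x, F x ∂μ +
      (l ^ 2 * σ ^ 2 / 2 + C * (√((N : ℝ) + 1))⁻¹))) Filter.atTop
      (nhds (Real.exp (l * ∫ x, F x ∂μ + (l ^ 2 * σ ^ 2 / 2 + C * 0)))) := by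
    have h0 : Filter.Tendsto (fun N : ℕ => (√((N : ℝ) + 1))⁻¹) Filter.atTop (nhds 0) :=
      tendsto_inv_atTop_zero.comp (Real.tendsto_sqrt_atTop.comp
        (Filter.tendsto_atTop_add_const_right _ _ tendsto_natCast_atTop_atTop))
    exact (Real.continuous_exp.tendsto _).comp
      (((h0.const_mul C).const_add _).const_add _)
  simpa using ge_of_tendsto' hlim hN

end Semigroup

end Concentration

section LogSumExp

variable {ι : Type*} [Fintype ι]

/-- The smooth approximation `β⁻¹ log ∑ᵢ exp (β xᵢ)` of the maximum. -/
noncomputable def logSumExp (β : ℝ) (x : ι → ℝ) : ℝ := β⁻¹ * Real.log (∑ i, Real.exp (β * x i))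

/-- The weights of the gradient of `logSumExp`. -/
noncomputable def softmax (β : ℝ) (x : ι → ℝ) (i : ι) : ℝ :=
  Real.exp (β * x i) / ∑ j, Real.exp (β * x j)

variable [Nonempty ι]

lemma sum_exp_pos (β : ℝ) (x : ι → ℝ) : 0 < ∑ i, Real.exp (β * x i) :=
  Finset.sum_pos (fun _ _ => Real.exp_pos _) Finset.univ_nonempty

lemma softmax_nonneg (β : ℝ) (x : ι → ℝ) (i : ι) : 0 ≤ softmax β x i :=
  div_nonneg (Real.exp_pos _).le (sum_exp_pos β x).le

lemma sum_softmax (β : ℝ) (x : ι → ℝ) : ∑ i, softmax β x i = 1 := by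
  simp only [softmax, ← Finset.sum_div]
  exact div_self (sum_exp_pos β x).ne'

lemma continuous_softmax (β : ℝ) (i : ι) : Continuous fun x : ι → ℝ => softmax β x i :=
  Continuous.div (by fun_prop) (by fun_prop) fun x => (sum_exp_pos β x).ne'

lemma sup'_le_logSumExp {β : ℝ} (hβ : 0 < β) (x : ι → ℝ) :
    Finset.univ.sup' Finset.univ_nonempty x ≤ logSumExp β x := by
  refine Finset.sup'_le _ _ fun i _ => ?_
  rw [logSumExp, inv_mul_eq_div, le_div_iff₀ hβ, Real.le_log_iff_exp_le (sum_exp_pos β x),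
    mul_comm]
  exact Finset.single_le_sum (f := fun i => Real.exp (β * x i)) (fun _ _ => (Real.exp_pos _).le)
    (Finset.mem_univ i)

lemma logSumExp_le_sup'_add {β : ℝ} (hβ : 0 < β) (x : ι → ℝ) :
    logSumExp β x ≤
      Finset.univ.sup' Finset.univ_nonempty x + Real.log (Fintype.card ι) * β⁻¹ := by
  set m := Finset.univ.sup' Finset.univ_nonempty x with hm
  have h : ∑ i, Real.exp (β * x i) ≤ Fintype.card ι * Real.exp (β * m) := by
    rw [← nsmul_eq_mul]
    refine Finset.sum_le_card_nsmul _ _ _ fun i hi => ?_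
    gcongr
    exact Finset.le_sup' x hi
  have h2 := Real.log_le_log (sum_exp_pos β x) h
  rw [Real.log_mul (by simp) (Real.exp_pos _).ne', Real.log_exp] at h2
  have := mul_le_mul_of_nonneg_left h2 (inv_pos.2 hβ).le
  rw [mul_add, inv_mul_cancel_left₀ hβ.ne'] at this
  rw [logSumExp]
  linarith

lemma lipschitzWith_logSumExp {β : ℝ} (hβ : 0 < β) :
    LipschitzWith 1 (logSumExp β : (ι → ℝ) → ℝ) := by
  refine LipschitzWith.of_le_add fun x y => ?_
  have h : ∑ i, Real.exp (β * x i) ≤ Real.exp (β * dist x y) * ∑ i, Real.exp (β * y i) := by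
    rw [Finset.mul_sum]
    refine Finset.sum_le_sum fun i _ => ?_
    rw [← Real.exp_add, ← mul_add]
    gcongr
    have h1 := dist_le_pi_dist x y i
    rw [Real.dist_eq] at h1
    linarith [le_abs_self (x i - y i)]
  have h2 := Real.log_le_log (sum_exp_pos β x) h
  rw [Real.log_mul (Real.exp_pos _).ne' (sum_exp_pos β y).ne', Real.log_exp] at h2
  have := mul_le_mul_of_nonneg_left h2 (inv_pos.2 hβ).le
  rw [mul_add, inv_mul_cancel_left₀ hβ.ne'] at this
  simp only [logSumExp]
  linarith

lemma logSumExp_add_sub (β : ℝ) (x z : ι → ℝ) :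
    logSumExp β (x + z) - logSumExp β x =
      β⁻¹ * Real.log (∑ i, softmax β x i * Real.exp (β * z i)) := by
  rw [logSumExp, logSumExp, ← mul_sub,
    ← Real.log_div (sum_exp_pos β _).ne' (sum_exp_pos β x).ne', Finset.sum_div]
  congr 2
  refine Finset.sum_congr rfl fun i _ => ?_
  rw [softmax, Pi.add_apply, mul_add, Real.exp_add]
  ring

lemma abs_logSumExp_add_sub_sub_le {β : ℝ} (hβ : 0 < β) (x z : ι → ℝ) :
    |logSumExp β (x + z) - logSumExp β x - ∑ i, softmax β x i * z i| ≤ 2 * β * ‖z‖ ^ 2 := by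
  have hp := softmax_nonneg β x
  have hp1 := sum_softmax β x
  have hzi : ∀ i, |z i| ≤ ‖z‖ := norm_le_pi_norm z
  have hpz : |∑ i, softmax β x i * z i| ≤ ‖z‖ := by
    refine (Finset.abs_sum_le_sum_abs _ _).trans ?_
    calc ∑ i, |softmax β x i * z i| ≤ ∑ i, softmax β x i * ‖z‖ := by
          refine Finset.sum_le_sum fun i _ => ?_
          rw [abs_mul, abs_of_nonneg (hp i)]
          exact mul_le_mul_of_nonneg_left (hzi i) (hp i)
      _ = ‖z‖ := by rw [← Finset.sum_mul, hp1, one_mul]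
  by_cases hz : β * ‖z‖ ≤ 1
  · have hlow : Real.exp (β * ∑ i, softmax β x i * z i) ≤
        ∑ i, softmax β x i * Real.exp (β * z i) := by
      have := convexOn_exp.map_sum_le (t := Finset.univ) (w := softmax β x)
        (p := fun i => β * z i) (fun i _ => hp i) hp1 (fun _ _ => Set.mem_univ _)
      simp only [smul_eq_mul] at this
      rw [Finset.mul_sum]
      simpa only [mul_left_comm β] using this
    have hup : ∑ i, softmax β x i * Real.exp (β * z i) ≤
        1 + β * ∑ i, softmax β x i * z i + (β * ‖z‖) ^ 2 := by
      calc _ ≤ ∑ i, softmax β x i * (1 + β * z i + (β * ‖z‖) ^ 2) := by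
            refine Finset.sum_le_sum fun i _ => mul_le_mul_of_nonneg_left ?_ (hp i)
            have h1 : |β * z i| ≤ β * ‖z‖ := by
              rw [abs_mul, abs_of_pos hβ]
              exact mul_le_mul_of_nonneg_left (hzi i) hβ.le
            have h2 := (abs_le.1 (Real.abs_exp_sub_one_sub_id_le (h1.trans hz))).2
            have h3 : (β * z i) ^ 2 ≤ (β * ‖z‖) ^ 2 := sq_le_sq' (abs_le.1 h1).1 (abs_le.1 h1).2
            linarith
        _ = _ := by
            simp only [mul_add, mul_one, Finset.sum_add_distrib, ← Finset.sum_mul, hp1, one_mul]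
            rw [Finset.mul_sum]
            congr 2
            exact Finset.sum_congr rfl fun i _ => by ring
    have hTpos := (Real.exp_pos _).trans_le hlow
    have hlog1 := (Real.le_log_iff_exp_le hTpos).2 hlow
    have hlog2 := (Real.log_le_sub_one_of_pos hTpos).trans (sub_le_sub_right hup 1)
    have h1 := mul_le_mul_of_nonneg_left hlog1 (inv_pos.2 hβ).le
    have h2 := mul_le_mul_of_nonneg_left hlog2 (inv_pos.2 hβ).le
    rw [inv_mul_cancel_left₀ hβ.ne'] at h1
    have e : β⁻¹ * (1 + β * ∑ i, softmax β x i * z i + (β * ‖z‖) ^ 2 - 1) =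
        ∑ i, softmax β x i * z i + β * ‖z‖ ^ 2 := by
      field_simp; ring
    rw [e] at h2
    rw [logSumExp_add_sub, abs_of_nonneg (by linarith)]
    have : 0 ≤ β * ‖z‖ ^ 2 := by positivity
    linarith
  · have h1 := (lipschitzWith_logSumExp (ι := ι) hβ).dist_le_mul (x + z) x
    simp only [NNReal.coe_one, one_mul, dist_eq_norm, add_sub_cancel_left,
      Real.norm_eq_abs] at h1
    have h2 := abs_sub (logSumExp β (x + z) - logSumExp β x) (∑ i, softmax β x i * z i)
    nlinarith [norm_nonneg z]

/-- The Laplace transform of the maximum of a centered Gaussian vector. -/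
theorem integral_exp_mul_sup'_le (μ : Measure (ι → ℝ)) [IsGaussian μ]
    (hμ : ∀ L : StrongDual ℝ (ι → ℝ), μ[L] = 0) {σ : ℝ}
    (hσ : ∀ i, ∫ z, (z i) ^ 2 ∂μ ≤ σ ^ 2) {l : ℝ} (hl : 0 ≤ l) :
    Integrable (fun x => Real.exp (l * Finset.univ.sup' Finset.univ_nonempty x)) μ ∧
      ∫ x, Real.exp (l * Finset.univ.sup' Finset.univ_nonempty x) ∂μ ≤
        Real.exp (l * ∫ x, Finset.univ.sup' Finset.univ_nonempty x ∂μ + l ^ 2 * σ ^ 2 / 2) := by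
  set S : (ι → ℝ) → ℝ := fun x => Finset.univ.sup' Finset.univ_nonempty x with hS
  have hSc : Continuous S :=
    Continuous.finset_sup'_apply Finset.univ_nonempty fun i _ => continuous_apply i
  have hSn : ∀ x, |S x| ≤ ‖x‖ := fun x => by
    obtain ⟨i, -, hi⟩ := Finset.exists_mem_eq_sup' Finset.univ_nonempty x
    simp only [hS, hi]
    exact norm_le_pi_norm x i
  have hn1 : Integrable (fun x : ι → ℝ => ‖x‖) μ := (IsGaussian.integrable_id (μ := μ)).norm
  have hSi : Integrable S μ := hn1.mono' (by fun_prop) (ae_of_all _ hSn)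
  set K : Set (StrongDual ℝ (ι → ℝ)) :=
    convexHull ℝ (Set.range fun i => ContinuousLinearMap.proj (R := ℝ) (φ := fun _ : ι => ℝ) i)
  have hsq : ∀ L : StrongDual ℝ (ι → ℝ), Integrable (fun z => (L z) ^ 2) μ := fun L =>
    (IsGaussian.memLp_dual μ L 2 (by simp)).integrable_sq
  have hK1 : K ⊆ Metric.closedBall 0 1 := by
    refine convexHull_min ?_ (convex_closedBall _ _)
    rintro _ ⟨i, rfl⟩
    rw [mem_closedBall_zero_iff]
    exact ContinuousLinearMap.opNorm_le_bound _ zero_le_one fun z => by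
      simpa using norm_le_pi_norm z i
  have hKσ : K ⊆ {L | ∫ z, (L z) ^ 2 ∂μ ≤ σ ^ 2} := by
    refine convexHull_min ?_ fun L hL M hM a b ha hb hab => ?_
    · rintro _ ⟨i, rfl⟩
      exact hσ i
    · calc ∫ z, ((a • L + b • M) z) ^ 2 ∂μ ≤ ∫ z, (a * (L z) ^ 2 + b * (M z) ^ 2) ∂μ := by
            refine integral_mono (hsq _) (((hsq L).const_mul a).add ((hsq M).const_mul b))
              fun z => ?_
            have : b = 1 - a := by linarith
            subst this
            have : 0 ≤ a * (1 - a) * (L z - M z) ^ 2 := by positivity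
            simp
            linarith
        _ = a * ∫ z, (L z) ^ 2 ∂μ + b * ∫ z, (M z) ^ 2 ∂μ := by
            rw [integral_add ((hsq L).const_mul a) ((hsq M).const_mul b), integral_const_mul,
              integral_const_mul]
        _ ≤ a * σ ^ 2 + b * σ ^ 2 := by
            gcongr
            exacts [hL, hM]
        _ = σ ^ 2 := by rw [← add_mul, hab, one_mul]
  have hKc : IsClosed K := (Set.finite_range _).isClosed_convexHull _
  have hexpi : ∀ {F : (ι → ℝ) → ℝ} (c : ℝ), Continuous F → (∀ x, F x ≤ ‖x‖ + c) →
      Integrable (fun x => Real.exp (l * F x)) μ := fun {F} c hF hFn => by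
    refine ((integrable_exp_mul_norm_of_isGaussian μ l).const_mul (Real.exp (l * c))).mono'
      (by fun_prop) (ae_of_all _ fun x => ?_)
    rw [Real.norm_eq_abs, Real.abs_exp, ← Real.exp_add, Real.exp_le_exp, ← mul_add, add_comm c]
    exact mul_le_mul_of_nonneg_left (hFn x) hl
  have hESi : Integrable (fun x => Real.exp (l * S x)) μ :=
    hexpi 0 hSc fun x => by simpa using (le_abs_self _).trans (hSn x)
  refine ⟨hESi, ?_⟩
  have : ProperSpace (StrongDual ℝ (ι → ℝ)) := FiniteDimensional.proper ℝ _
  have hβ : ∀ β : ℝ, 0 < β → ∫ x, Real.exp (l * S x) ∂μ ≤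
      Real.exp (l * (∫ x, S x ∂μ + Real.log (Fintype.card ι) * β⁻¹) + l ^ 2 * σ ^ 2 / 2) := by
    intro β hβ
    have hLip := lipschitzWith_logSumExp (ι := ι) hβ
    have hFi : Integrable (logSumExp β) μ := by
      refine (hSi.abs.add (integrable_const |Real.log (Fintype.card ι) * β⁻¹|)).mono'
        hLip.continuous.aestronglyMeasurable (ae_of_all _ fun x => ?_)
      have h1 := sup'_le_logSumExp hβ x
      have h2 := logSumExp_le_sup'_add hβ x
      simp only [Pi.add_apply, Real.norm_eq_abs, hS]
      refine abs_le.2 ⟨?_, ?_⟩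
      · linarith [neg_abs_le (Finset.univ.sup' Finset.univ_nonempty x),
          abs_nonneg (Real.log (Fintype.card ι) * β⁻¹)]
      · linarith [le_abs_self (Finset.univ.sup' Finset.univ_nonempty x),
          le_abs_self (Real.log (Fintype.card ι) * β⁻¹)]
    have hmain := integral_exp_mul_le_of_isGaussian μ hμ (convex_convexHull ℝ _) hKc
      (fun L hL => mem_closedBall_zero_iff.1 (hK1 hL)) (fun L hL => hKσ hL) hLip
      (F' := fun x => ∑ i, softmax β x i • ContinuousLinearMap.proj (R := ℝ) (φ := fun _ => ℝ) i)
      (continuous_finsetSum _ fun i _ => (continuous_softmax β i).smul continuous_const)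
      (fun x => (convex_convexHull ℝ _).sum_mem (fun i _ => softmax_nonneg β x i)
        (sum_softmax β x) fun i _ => subset_convexHull ℝ _ ⟨i, rfl⟩)
      (B := 2 * β) (by positivity)
      (fun x z => by simpa using abs_logSumExp_add_sub_sub_le hβ x z) hl
    calc ∫ x, Real.exp (l * S x) ∂μ ≤ ∫ x, Real.exp (l * logSumExp β x) ∂μ := by
          refine integral_mono hESi (hexpi (Real.log (Fintype.card ι) * β⁻¹) hLip.continuous
            fun x => ?_) fun x => ?_
          · exact (logSumExp_le_sup'_add hβ x).trans
              (by gcongr; exact (le_abs_self _).trans (hSn x))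
          · simp only
            gcongr
            exact sup'_le_logSumExp hβ x
      _ ≤ _ := hmain
      _ ≤ _ := by
          gcongr
          calc ∫ x, logSumExp β x ∂μ ≤ ∫ x, (S x + Real.log (Fintype.card ι) * β⁻¹) ∂μ :=
                integral_mono hFi (hSi.add (integrable_const _)) (logSumExp_le_sup'_add hβ)
            _ = _ := by
                rw [integral_add hSi (integrable_const _)]
                simp
  have hlim : Filter.Tendsto (fun β : ℝ => Real.exp (l * (∫ x, S x ∂μ +
      Real.log (Fintype.card ι) * β⁻¹) + l ^ 2 * σ ^ 2 / 2)) Filter.atTop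
      (nhds (Real.exp (l * (∫ x, S x ∂μ + Real.log (Fintype.card ι) * 0) +
        l ^ 2 * σ ^ 2 / 2))) :=
    (Real.continuous_exp.tendsto _).comp
      ((((tendsto_inv_atTop_zero.const_mul _).const_add _).const_mul l).add_const _)
  simpa using ge_of_tendsto hlim ((Filter.eventually_gt_atTop 0).mono hβ)

end LogSumExp

/-- Borell-TIS inequality, mean form (B.3), for a finite index set:
if `X` is a centered Gaussian random vector in `ℝⁿ`, `σ² = maxᵢ Var(Xᵢ)` with `σ > 0`,
and `μ(X) = E[maxᵢ Xᵢ]`, then for every `u ≥ 0`,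
`P(maxᵢ Xᵢ > u + μ(X)) ≤ exp(−u²/(2σ²))`. -/
theorem borell_TIS_mean {Ω : Type*} [MeasurableSpace Ω] (Q : Measure Ω)
    [IsProbabilityMeasure Q] {n : ℕ} [NeZero n]
    (X : Ω → Fin n → ℝ) (hXmeas : ∀ i, Measurable fun ω => X ω i)
    (hXgauss : ∀ a : Fin n → ℝ, ∃ v : ℝ≥0,
      Measure.map (fun ω => ∑ i, a i * X ω i) Q = gaussianReal 0 v)
    (σ : ℝ) (hσ : 0 < σ)
    (hσ2 : σ ^ 2 = Finset.univ.sup' Finset.univ_nonempty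
      fun i => variance (fun ω => X ω i) Q)
    (μX : ℝ)
    (hμX : μX = ∫ ω, Finset.univ.sup' Finset.univ_nonempty (fun i => X ω i) ∂Q)
    (u : ℝ) (hu : 0 ≤ u) :
    (Q {ω | u + μX < Finset.univ.sup' Finset.univ_nonempty (fun i => X ω i)}).toReal
      ≤ Real.exp (-u ^ 2 / (2 * σ ^ 2)) := by
  set μ : Measure (Fin n → ℝ) := Q.map X with hμdef
  have hXm : Measurable X := measurable_pi_lambda _ hXmeas
  have hL : ∀ L : StrongDual ℝ (Fin n → ℝ), ∃ v : ℝ≥0, μ.map L = gaussianReal 0 v := fun L => by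
    obtain ⟨v, hv⟩ := hXgauss fun i => L (Pi.single i 1)
    refine ⟨v, ?_⟩
    rw [hμdef, Measure.map_map (by fun_prop) hXm, ← hv]
    congr 1
    ext ω
    rw [Function.comp_apply, ← ContinuousLinearMap.coe_coe, LinearMap.pi_apply_eq_sum_univ]
    refine Finset.sum_congr rfl fun i _ => ?_
    have hsingle : (fun j => if i = j then (1 : ℝ) else 0) = Pi.single i 1 := by
      ext j; simp [Pi.single_apply, eq_comm]
    rw [hsingle, smul_eq_mul, mul_comm]
  have : IsGaussian μ := isGaussian_of_map_eq_gaussianReal fun L => ⟨0, hL L⟩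
  have hcent : ∀ L : StrongDual ℝ (Fin n → ℝ), μ[L] = 0 := fun L => by
    obtain ⟨v, hv⟩ := hL L
    have h := integral_map (μ := μ) (φ := L) (f := fun x : ℝ => x) (by fun_prop) (by fun_prop)
    rw [← h, hv, integral_id_gaussianReal]
  have hvar : ∀ i, ∫ z, (z i) ^ 2 ∂μ ≤ σ ^ 2 := fun i => by
    have hmean : ∫ ω, X ω i ∂Q = 0 := by
      have h := hcent (ContinuousLinearMap.proj i)
      rw [hμdef, integral_map hXm.aemeasurable (by fun_prop)] at h
      exact h
    have hsq : Continuous fun z : Fin n → ℝ => (z i) ^ 2 := (continuous_apply i).pow 2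
    rw [hμdef, integral_map hXm.aemeasurable hsq.aestronglyMeasurable,
      ← variance_of_integral_eq_zero (hXmeas i).aemeasurable hmean, hσ2]
    exact Finset.le_sup' (fun i => variance (fun ω => X ω i) Q) (Finset.mem_univ i)
  have hSc : Continuous fun x : Fin n → ℝ => Finset.univ.sup' Finset.univ_nonempty x :=
    Continuous.finset_sup'_apply Finset.univ_nonempty fun i _ => continuous_apply i
  obtain ⟨hexpi, hle⟩ := integral_exp_mul_sup'_le μ hcent hvar
    (l := u / σ ^ 2) (by positivity)
  have hμX' : μX = ∫ x, Finset.univ.sup' Finset.univ_nonempty x ∂μ := by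
    rw [hμX, hμdef, integral_map hXm.aemeasurable hSc.aestronglyMeasurable]
  rw [← hμX'] at hle
  have hpre : Q {ω | u + μX < Finset.univ.sup' Finset.univ_nonempty (fun i => X ω i)} =
      μ {x | u + μX < Finset.univ.sup' Finset.univ_nonempty x} := by
    rw [hμdef, Measure.map_apply hXm (measurableSet_lt measurable_const hSc.measurable)]
    rfl
  rw [hpre]
  change μ.real _ ≤ _
  calc μ.real {x | u + μX < Finset.univ.sup' Finset.univ_nonempty x}
      ≤ μ.real {x | u + μX ≤ Finset.univ.sup' Finset.univ_nonempty x} :=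
        measureReal_mono (Set.ofPred_subset_ofPred.2 fun x hx => le_of_lt hx)
    _ ≤ Real.exp (-(u / σ ^ 2) * (u + μX)) *
          mgf (fun x => Finset.univ.sup' Finset.univ_nonempty x) μ (u / σ ^ 2) :=
        measure_ge_le_exp_mul_mgf _ (by positivity) hexpi
    _ ≤ Real.exp (-(u / σ ^ 2) * (u + μX)) *
          Real.exp (u / σ ^ 2 * μX + (u / σ ^ 2) ^ 2 * σ ^ 2 / 2) := by
        gcongr
        exact hle
    _ = Real.exp (-u ^ 2 / (2 * σ ^ 2)) := by
        rw [← Real.exp_add]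
        congr 1
        field_simp
        ring
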